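/- Let A be a C*-algebra. Every quasi-nilpotent element of A belongs to CQ(A). Moreover, if a ∈ A is quasi-nilpotent, then ab ∈ CQ(A) and ba ∈ CQ(A) for every b ∈ A. -/

import Mathlib

open Filter Topology Pointwise

namespace CQP

variable {R : Type*} [NonUnitalRing R] [TopologicalSpace R]

/-- `I` is a closed two-sided ideal of the (C*-)algebra `S` (a subset of the ambient algebra). -/
def IsIdealOf (I S : Set R) : Prop :=
  I ⊆ S ∧ IsClosed I ∧ (0 : R) ∈ I ∧
  (∀ x ∈ I, ∀ y ∈ I, x + y ∈ I) ∧ (∀ x ∈ I, -x ∈ I) ∧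
  (∀ x ∈ I, ∀ a ∈ S, a * x ∈ I ∧ x * a ∈ I)

/-- The centre of the algebra `S`. -/
def centerOf (S : Set R) : Set R := {z ∈ S | ∀ x ∈ S, z * x = x * z}

/-- `e` is a unit for `S` relative to (modulo) the ideal `M`. -/
def IsRelUnitMod (S M : Set R) (e : R) : Prop :=
  e ∈ S ∧ ∀ x ∈ S, x - x * e ∈ M ∧ x - e * x ∈ M

/-- `M` is a modular maximal ideal of the algebra `S`. -/
def IsModMaxIdealOf (M S : Set R) : Prop :=
  IsIdealOf M S ∧ M ≠ S ∧
  (∀ I, IsIdealOf I S → M ⊆ I → I = M ∨ I = S) ∧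
  ∃ e, IsRelUnitMod S M e

/-- The algebra `S` is weakly central. -/
def WeaklyCentral (S : Set R) : Prop :=
  (∀ M, IsModMaxIdealOf M S → ¬ centerOf S ⊆ M) ∧
  (∀ M N, IsModMaxIdealOf M S → IsModMaxIdealOf N S →
    M ∩ centerOf S = N ∩ centerOf S → M = N)

/-- The algebra `S` has the centre-quotient property: every central element of a quotient
of `S` lifts to a central element of `S` modulo the ideal. -/
def HasCQ (S : Set R) : Prop :=
  ∀ I, IsIdealOf I S → ∀ a ∈ S, (∀ x ∈ S, a * x - x * a ∈ I) →
    ∃ z ∈ centerOf S, a - z ∈ I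

/-- `a` is a CQ-element of the algebra `S`. -/
def IsCQElem (S : Set R) (a : R) : Prop :=
  a ∈ S ∧ ∀ I, IsIdealOf I S → (∀ x ∈ S, a * x - x * a ∈ I) →
    ∃ z ∈ centerOf S, a - z ∈ I

/-- The set of CQ-elements of `S`. -/
def CQset (S : Set R) : Set R := {a | IsCQElem S a}

/-- The set `T_A` of modular maximal ideals witnessing the failure of weak centrality. -/
def Tset (S : Set R) : Set (Set R) :=
  {M | IsModMaxIdealOf M S ∧
    (centerOf S ⊆ M ∨ ∃ N, IsModMaxIdealOf N S ∧ N ≠ M ∧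
      ¬ centerOf S ⊆ M ∧ ¬ centerOf S ⊆ N ∧ M ∩ centerOf S = N ∩ centerOf S)}

/-- The closed two-sided ideal of `S` generated by the set `X`. -/
def genIdealOf (S X : Set R) : Set R := ⋂₀ {I | IsIdealOf I S ∧ X ⊆ I}

/-- The quotient `A/J` (of the full algebra by the ideal `J`) has the centre-quotient
property, expressed via the correspondence between ideals of `A/J` and ideals of `A`
containing `J`. -/
def HasCQmod (J : Set R) : Prop :=
  ∀ I : Set R, IsIdealOf I (Set.univ : Set R) → J ⊆ I → ∀ a : R,
    (∀ x : R, a * x - x * a ∈ I) →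
      ∃ z : R, (∀ x : R, z * x - x * z ∈ J) ∧ a - z ∈ I


end CQP

open CQP

/-- `qpow a n = a ^ (n+1)`, powers of an element of a non-unital ring. -/
def qpow {R : Type*} [NonUnitalRing R] (a : R) : ℕ → R
  | 0 => a
  | n + 1 => qpow a n * a

/-- An element `a` is quasi-nilpotent if its spectral radius
`ν(a) = lim_n ‖aⁿ‖^(1/n)` is zero. -/
def IsQuasinilpotent {R : Type*} [NonUnitalNormedRing R] (a : R) : Prop :=
  Filter.Tendsto (fun n : ℕ => ‖qpow a n‖ ^ (1 / (n + 1 : ℝ)))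
    Filter.atTop (nhds 0)

theorem qpow_succ' {R : Type*} [NonUnitalRing R] (a : R) (n : ℕ) :
    qpow a (n + 1) = a * qpow a n := by
  induction n with
  | zero => rfl
  | succ n ih => exact (congrArg (· * a) ih).trans (mul_assoc ..)

theorem norm_qpow_le {R : Type*} [NonUnitalNormedRing R] (a : R) (n : ℕ) :
    ‖qpow a n‖ ≤ ‖a‖ ^ (n + 1) := by
  induction n with
  | zero => simp [qpow]
  | succ n ih =>
    rw [qpow, pow_succ]
    exact (norm_mul_le _ _).trans (mul_le_mul_of_nonneg_right ih (norm_nonneg _))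

theorem qpow_mul_of_commute {R : Type*} [NonUnitalRing R] {x y : R}
    (h : Commute (x * y) y) (n : ℕ) : qpow (x * y) n = qpow x n * qpow y n := by
  have hn : ∀ n, Commute (x * y) (qpow y n) := by
    intro n
    induction n with
    | zero => exact h
    | succ n ih => exact ih.mul_right h
  induction n with
  | zero => rfl
  | succ n ih =>
    rw [qpow, ih, mul_assoc, ← (hn n).eq, qpow_succ' y, qpow]
    simp only [mul_assoc]

theorem coe_qpow {R : Type*} [NonUnitalRing R] (J : TwoSidedIdeal R) (x : R) (n : ℕ) :
    ((qpow x n : R) : J.ringCon.Quotient) = qpow (x : J.ringCon.Quotient) n := by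
  induction n with
  | zero => rfl
  | succ n ih => rw [qpow, RingCon.coe_mul, ih, qpow]

theorem qpow_mul_sub_mem {R : Type*} [NonUnitalRing R] (J : TwoSidedIdeal R) {x y : R}
    (h : x * y * y - y * (x * y) ∈ J) (n : ℕ) :
    qpow (x * y) n - qpow x n * qpow y n ∈ J := by
  rw [← TwoSidedIdeal.rel_iff, ← RingCon.eq] at h ⊢
  rw [RingCon.coe_mul, coe_qpow, coe_qpow, coe_qpow, RingCon.coe_mul]
  exact qpow_mul_of_commute (x := (x : J.ringCon.Quotient)) (y := (y : J.ringCon.Quotient)) h n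

namespace CQP

/-- A set satisfying `IsIdealOf` in the full algebra, as a bundled two-sided ideal. -/
def IsIdealOf.toTwoSidedIdeal {R : Type*} [NonUnitalRing R] [TopologicalSpace R] {I : Set R}
    (hI : IsIdealOf I Set.univ) : TwoSidedIdeal R :=
  TwoSidedIdeal.mk' I hI.2.2.1 (fun hx hy => hI.2.2.2.1 _ hx _ hy) (fun hx => hI.2.2.2.2.1 _ hx)
    (fun hy => (hI.2.2.2.2.2 _ hy _ trivial).1) (fun hx => (hI.2.2.2.2.2 _ hx _ trivial).2)

theorem IsIdealOf.mem_toTwoSidedIdeal {R : Type*} [NonUnitalRing R] [TopologicalSpace R]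
    {I : Set R} (hI : IsIdealOf I Set.univ) {x : R} : x ∈ hI.toTwoSidedIdeal ↔ x ∈ I :=
  TwoSidedIdeal.mem_mk' ..

end CQP

theorem IsQuasinilpotent.tendsto_pow_mul_norm_qpow {R : Type*} [NonUnitalNormedRing R] {a : R}
    (ha : IsQuasinilpotent a) {K : ℝ} (hK : 0 ≤ K) :
    Tendsto (fun n : ℕ => K ^ (n + 1) * ‖qpow a n‖) atTop (𝓝 0) := by
  have hη : (0 : ℝ) < 1 / (2 * (K + 1)) := by positivity
  have hgeom : Tendsto (fun n : ℕ => (1 / 2 : ℝ) ^ (n + 1)) atTop (𝓝 0) :=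
    (tendsto_pow_atTop_nhds_zero_of_lt_one (by norm_num) (by norm_num)).comp
      (tendsto_add_atTop_nat 1)
  refine squeeze_zero' (Eventually.of_forall fun n => by positivity) ?_ hgeom
  filter_upwards [ha.eventually (gt_mem_nhds hη)] with n hn
  have hpow : ‖qpow a n‖ ≤ (1 / (2 * (K + 1))) ^ (n + 1) := by
    have := pow_le_pow_left₀ (by positivity) hn.le (n + 1)
    rwa [one_div (n + 1 : ℝ), ← Nat.cast_succ, Nat.succ_eq_add_one,
      Real.rpow_inv_natCast_pow (norm_nonneg _) n.succ_ne_zero] at this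
  calc K ^ (n + 1) * ‖qpow a n‖ ≤ K ^ (n + 1) * (1 / (2 * (K + 1))) ^ (n + 1) := by gcongr
    _ = (K * (1 / (2 * (K + 1)))) ^ (n + 1) := (mul_pow ..).symm
    _ ≤ (1 / 2) ^ (n + 1) := by
      gcongr
      rw [mul_one_div, div_le_div_iff₀ (by positivity) (by norm_num)]
      linarith

/-- A continuous function vanishing on `(-∞, ε]` and equal to `(t - ε) / t ^ k` on `[ε, ∞)`. -/
noncomputable def cutoff (ε : ℝ) (k : ℕ) (t : ℝ) : ℝ := max (t - ε) 0 / max t ε ^ k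

section cutoff

variable {ε : ℝ} (hε : 0 < ε)
include hε

theorem continuous_cutoff (k : ℕ) : Continuous (cutoff ε k) := by
  unfold cutoff
  exact Continuous.div (by fun_prop) (by fun_prop)
    fun t => (pow_pos (hε.trans_le (le_max_right t ε)) k).ne'

theorem cutoff_zero_right (k : ℕ) : cutoff ε k 0 = 0 := by
  simp [cutoff, hε.le]

theorem cutoff_succ_mul_self (k : ℕ) (t : ℝ) : cutoff ε (k + 1) t * t = cutoff ε k t := by
  unfold cutoff
  rcases le_total t ε with h | h
  · simp [max_eq_right (sub_nonpos.2 h)]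
  · have : t ≠ 0 := (hε.trans_le h).ne'
    rw [max_eq_left h, pow_succ, ← div_div, div_mul_cancel₀ _ this]

theorem norm_cutoff_le (k : ℕ) (t : ℝ) : ‖cutoff ε (k + 1) t‖ ≤ ε⁻¹ ^ k := by
  have hm : 0 < max t ε := hε.trans_le (le_max_right _ _)
  have h0 : 0 ≤ max (t - ε) 0 := le_max_right _ _
  have h1 : max (t - ε) 0 ≤ max t ε :=
    max_le ((sub_le_self _ hε.le).trans (le_max_left _ _)) hm.le
  rw [Real.norm_of_nonneg (by unfold cutoff; positivity), cutoff, pow_succ', inv_pow, ← one_div,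
    ← div_div]
  have h2 : max (t - ε) 0 / max t ε ≤ 1 := (div_le_one hm).2 h1
  gcongr
  exact le_max_right _ _

theorem abs_mul_one_sub_cutoff_sq_le {t : ℝ} (ht : 0 ≤ t) :
    |t * (1 - cutoff ε 1 t) ^ 2| ≤ ε := by
  unfold cutoff
  rw [abs_of_nonneg (by positivity)]
  rcases le_total t ε with h | h
  · simpa [max_eq_right (sub_nonpos.2 h)] using h
  · have h0 : 0 < t := hε.trans_le h
    rw [max_eq_left h, max_eq_left (sub_nonneg.2 h)]
    have : t * (1 - (t - ε) / t ^ 1) ^ 2 = ε * (ε / t) := by field_simp; ring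
    rw [this]
    exact mul_le_of_le_one_right hε.le ((div_le_one h0).2 h)

variable {A : Type*} [NonUnitalCStarAlgebra A]

theorem cfcₙ_cutoff_mul_qpow {h : A} (hh : IsSelfAdjoint h) (j k : ℕ) :
    cfcₙ (cutoff ε (j + (k + 1))) h * qpow h k = cfcₙ (cutoff ε j) h := by
  have step : ∀ j, cfcₙ (cutoff ε (j + 1)) h * h = cfcₙ (cutoff ε j) h := by
    intro j
    have hmul := cfcₙ_mul (cutoff ε (j + 1)) (fun t => t) h
      (continuous_cutoff hε _).continuousOn (cutoff_zero_right hε _)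
    rw [cfcₙ_id' ℝ h, funext (cutoff_succ_mul_self hε j)] at hmul
    exact hmul.symm
  induction k with
  | zero => exact step j
  | succ k ih => rw [qpow_succ', ← mul_assoc, ← add_assoc j, step, ih]

theorem norm_sub_mul_cfcₙ_cutoff_sq_le (c : A) :
    ‖c - c * cfcₙ (cutoff ε 1) (star c * c)‖ ^ 2 ≤ ε := by
  have hh : IsSelfAdjoint (star c * c) := .star_mul_self c
  set h := star c * c with hdef
  have hu : IsSelfAdjoint (cfcₙ (cutoff ε 1) h) := cfcₙ_predicate _ _
  have hcont := (continuous_cutoff hε 1).continuousOn (s := quasispectrum ℝ h)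
  have h0 := cutoff_zero_right hε 1
  have hcf : cfcₙ (fun t => t * (1 - cutoff ε 1 t) ^ 2) h =
      star (c - c * cfcₙ (cutoff ε 1) h) * (c - c * cfcₙ (cutoff ε 1) h) := by
    have h1 : (fun t => t * (1 - cutoff ε 1 t) ^ 2) = fun t =>
        (t - t * cutoff ε 1 t) - (cutoff ε 1 t * t - cutoff ε 1 t * (t * cutoff ε 1 t)) := by
      funext t; ring
    rw [h1, cfcₙ_sub (fun t => t - t * cutoff ε 1 t)
        (fun t => cutoff ε 1 t * t - cutoff ε 1 t * (t * cutoff ε 1 t)) h,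
      cfcₙ_sub (fun t => t) (fun t => t * cutoff ε 1 t) h,
      cfcₙ_sub (fun t => cutoff ε 1 t * t) (fun t => cutoff ε 1 t * (t * cutoff ε 1 t)) h,
      cfcₙ_mul (cutoff ε 1) (fun t => t * cutoff ε 1 t) h,
      cfcₙ_mul (cutoff ε 1) (fun t => t) h, cfcₙ_mul (fun t => t) (cutoff ε 1) h, cfcₙ_id' ℝ h]
    rw [star_sub, star_mul, hu.star_eq, hdef]
    noncomm_ring
  rw [sq, ← CStarRing.norm_star_mul_self, ← hcf]
  refine norm_cfcₙ_le fun t ht => abs_mul_one_sub_cutoff_sq_le hε ?_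
  let _ := CStarAlgebra.spectralOrder A
  have := CStarAlgebra.spectralOrderedRing A
  exact quasispectrum_nonneg_of_nonneg h (star_mul_self_nonneg c) t ht

end cutoff

theorem CQP.IsIdealOf.mem_of_central_of_qpow_sub_mem {A : Type*} [NonUnitalCStarAlgebra A]
    {I : Set A} (hI : IsIdealOf I Set.univ) {a c : A} (ha : IsQuasinilpotent a)
    (hc : ∀ x, c * x - x * c ∈ I) {K : ℝ} (hK : 0 ≤ K)
    (hy : ∀ n, ∃ y, qpow c n - y ∈ I ∧ ‖y‖ ≤ K ^ (n + 1) * ‖qpow a n‖) : c ∈ I := by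
  set J := hI.toTwoSidedIdeal
  have hJ : ∀ {x}, x ∈ J ↔ x ∈ I := hI.mem_toTwoSidedIdeal
  choose y hyI hyK using hy
  set h := star c * c
  have hh : IsSelfAdjoint h := .star_mul_self c
  have hpow : ∀ n, qpow h n - qpow (star c) n * y n ∈ I := by
    intro n
    have h1 : star c * c * c - c * (star c * c) ∈ J := by
      have := J.neg_mem (hJ.2 (hc (star c * c)))
      rwa [neg_sub] at this
    have h2 := J.add_mem (qpow_mul_sub_mem J h1 n)
      (J.mul_mem_left (qpow (star c) n) _ (hJ.2 (hyI n)))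
    rwa [mul_sub, sub_add_sub_cancel, hJ] at h2
  have hu : ∀ ε > 0, cfcₙ (cutoff ε 1) h ∈ I := by
    intro ε hε
    have hlim := ha.tendsto_pow_mul_norm_qpow (K := ε⁻¹ * (‖c‖ * K)) (by positivity)
    refine hI.2.1.mem_of_tendsto (f := fun n => cfcₙ (cutoff ε (1 + (n + 1))) h *
      (qpow h n - qpow (star c) n * y n)) (b := atTop) ?_
      (Eventually.of_forall fun n => (hI.2.2.2.2.2 _ (hpow n) _ trivial).1)
    rw [tendsto_iff_norm_sub_tendsto_zero]
    refine squeeze_zero (fun _ => norm_nonneg _) (fun n => ?_) hlim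
    rw [mul_sub, cfcₙ_cutoff_mul_qpow hε hh, sub_sub_cancel_left, norm_neg, add_comm 1]
    calc ‖cfcₙ (cutoff ε (n + 1 + 1)) h * (qpow (star c) n * y n)‖
        ≤ ‖cfcₙ (cutoff ε (n + 1 + 1)) h‖ * (‖qpow (star c) n‖ * ‖y n‖) :=
          (norm_mul_le _ _).trans (by gcongr; exact norm_mul_le _ _)
      _ ≤ ε⁻¹ ^ (n + 1) * (‖c‖ ^ (n + 1) * (K ^ (n + 1) * ‖qpow a n‖)) := by
          gcongr
          · exact norm_cfcₙ_le fun t _ => norm_cutoff_le hε (n + 1) t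
          · simpa using norm_qpow_le (star c) n
          · exact hyK n
      _ = (ε⁻¹ * (‖c‖ * K)) ^ (n + 1) * ‖qpow a n‖ := by rw [mul_pow, mul_pow]; ring
  rw [← hI.2.1.closure_eq, Metric.mem_closure_iff]
  intro δ hδ
  refine ⟨c * cfcₙ (cutoff ((δ / 2) ^ 2) 1) h,
    (hI.2.2.2.2.2 _ (hu _ (by positivity)) _ trivial).1, ?_⟩
  rw [dist_eq_norm]
  have := norm_sub_mul_cfcₙ_cutoff_sq_le (ε := (δ / 2) ^ 2) (by positivity) c
  exact (le_of_sq_le_sq this (by positivity)).trans_lt (half_lt_self hδ)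

/-- If an element of `A` lies in every ideal modulo which it is central, then it is a CQ-element. -/
theorem CQP.mem_CQset_of_forall_mem {R : Type*} [NonUnitalRing R] [TopologicalSpace R] {c : R}
    (h : ∀ I : Set R, IsIdealOf I Set.univ → (∀ x, c * x - x * c ∈ I) → c ∈ I) :
    c ∈ CQset (Set.univ : Set R) :=
  ⟨trivial, fun I hI hc => ⟨0, ⟨trivial, by simp⟩, by
    simpa using h I hI fun x => hc x trivial⟩⟩

/-- **Proposition 4.5 (b).** Every quasi-nilpotent element `a` of a C*-algebra `A`
belongs to `CQ(A)`; moreover `a*b ∈ CQ(A)` and `b*a ∈ CQ(A)` for every `b ∈ A`. -/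
theorem stmt15 {A : Type*} [NonUnitalCStarAlgebra A] (a : A)
    (ha : IsQuasinilpotent a) :
    a ∈ CQset (Set.univ : Set A) ∧
    ∀ b : A, a * b ∈ CQset (Set.univ : Set A) ∧ b * a ∈ CQset (Set.univ : Set A) := by
  have norm_mul_qpow_le : ∀ (b : A) (n : ℕ),
      ‖qpow a n‖ * ‖qpow b n‖ ≤ ‖b‖ ^ (n + 1) * ‖qpow a n‖ := fun b n => by
    rw [mul_comm]
    gcongr
    exact norm_qpow_le b n
  refine ⟨mem_CQset_of_forall_mem fun I hI hc => ?_, fun b =>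
    ⟨mem_CQset_of_forall_mem fun I hI hc => ?_, mem_CQset_of_forall_mem fun I hI hc => ?_⟩⟩
  · exact hI.mem_of_central_of_qpow_sub_mem ha hc zero_le_one fun n =>
      ⟨qpow a n, by simpa using hI.2.2.1, by simp⟩
  · exact hI.mem_of_central_of_qpow_sub_mem ha hc (norm_nonneg b) fun n =>
      ⟨qpow a n * qpow b n, hI.mem_toTwoSidedIdeal.1
        (qpow_mul_sub_mem _ (hI.mem_toTwoSidedIdeal.2 (hc b)) n),
        (norm_mul_le _ _).trans (norm_mul_qpow_le b n)⟩
  · exact hI.mem_of_central_of_qpow_sub_mem ha hc (norm_nonneg b) fun n =>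
      ⟨qpow b n * qpow a n, hI.mem_toTwoSidedIdeal.1
        (qpow_mul_sub_mem _ (hI.mem_toTwoSidedIdeal.2 (hc a)) n),
        (norm_mul_le _ _).trans ((mul_comm _ _).trans_le (norm_mul_qpow_le b n))⟩
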